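/- Let n ≥ 4 and 2 ≤ p ≤ n−2, and set D = (1/2)·p(n−p) + (4/3)·binom(p,2)·binom(n−p,2). Let R be an algebraic curvature tensor on ℝⁿ and let B < A be real numbers such that for every orthonormal basis (v¹,…,vⁿ) of ℝⁿ one has B < Σ_{i=1}^p Σ_{j=p+1}^n K(vⁱ,vʲ) < A. Then for every unit vector ω ∈ ⋀^p ℝⁿ, ⟨R^p ω, ω⟩ > B − D·(A−B). -/

import Mathlib

open scoped BigOperators RealInnerProductSpace

noncomputable section

/-- An algebraic curvature tensor on a real module: a quadrilinear form with the
symmetries of the Riemann curvature tensor. -/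
structure AlgCurv (V : Type*) [AddCommGroup V] [Module ℝ V] where
  T : V →ₗ[ℝ] V →ₗ[ℝ] V →ₗ[ℝ] V →ₗ[ℝ] ℝ
  antisym₁ : ∀ x y z w, T x y z w = - T y x z w
  antisym₂ : ∀ x y z w, T x y z w = - T x y w z
  pairsym : ∀ x y z w, T x y z w = T z w x y
  bianchi : ∀ x y z w, T x y z w + T y z x w + T z x y w = 0

/-- Coordinates of the exterior algebra of ℝⁿ in the orthonormal basis `e^S`,
`S` ranging over subsets of `{1,…,n}`. -/
abbrev ExtCoord (n : ℕ) := Finset (Fin n) → ℝ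

/-- The sign `(-1)^{#{m ∈ S : m < i}}`. -/
def sgn {n : ℕ} (i : Fin n) (S : Finset (Fin n)) : ℝ :=
  (-1 : ℝ) ^ (S.filter fun m => m < i).card

/-- Exterior multiplication `(aⁱ)*` by `e_i`, in coordinates. -/
def wedgeE {n : ℕ} (i : Fin n) (f : ExtCoord n) : ExtCoord n :=
  fun S => if i ∈ S then sgn i S * f (S.erase i) else 0

/-- Interior multiplication `aⁱ` by `e_i`, in coordinates. -/
def contrE {n : ℕ} (i : Fin n) (f : ExtCoord n) : ExtCoord n :=
  fun S => if i ∈ S then 0 else sgn i S * f (insert i S)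

/-- Weitzenböck operator built from curvature components via Witten's formula
`R^p = Σ_{i,j,k,l} R_{ijkl} (aⁱ)* aʲ (aᵏ)* aˡ`. -/
def weitzOp {n : ℕ} (c : Fin n → Fin n → Fin n → Fin n → ℝ) (f : ExtCoord n) : ExtCoord n :=
  ∑ i, ∑ j, ∑ k, ∑ l, c i j k l • wedgeE i (contrE j (wedgeE k (contrE l f)))

/-- The standard orthonormal basis vector `e_i` of ℝⁿ. -/
def estd {n : ℕ} (i : Fin n) : EuclideanSpace ℝ (Fin n) := EuclideanSpace.single i 1

/-- The Weitzenböck curvature operator of an algebraic curvature tensor on ℝⁿ. -/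
def weitz {n : ℕ} (R : AlgCurv (EuclideanSpace ℝ (Fin n))) (f : ExtCoord n) : ExtCoord n :=
  weitzOp (fun i j k l => R.T (estd i) (estd j) (estd k) (estd l)) f

/-- The inner product on the exterior algebra making the `e^S` orthonormal. -/
def extInner {n : ℕ} (f g : ExtCoord n) : ℝ := ∑ S : Finset (Fin n), f S * g S

/-- The basis element `e^S` of the exterior algebra. -/
def eB {n : ℕ} (S : Finset (Fin n)) : ExtCoord n := fun T => if T = S then 1 else 0

/-- Sectional curvature `K(u,v) = -R(u,v,u,v)` (paper's sign convention). -/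
def sectK {V : Type*} [AddCommGroup V] [Module ℝ V] (R : AlgCurv V) (u v : V) : ℝ :=
  - R.T u v u v

/-- Wedging with a vector `x ∈ ℝⁿ`, in coordinates. -/
def wedgeV {n : ℕ} (x : EuclideanSpace ℝ (Fin n)) (f : ExtCoord n) : ExtCoord n :=
  ∑ i, x i • wedgeE i f

/-- The wedge product `u¹ ∧ … ∧ u^p` of a family of vectors. -/
def wedgeFam {n p : ℕ} (u : Fin p → EuclideanSpace ℝ (Fin n)) : ExtCoord n :=
  (List.ofFn u).foldr wedgeV (eB ∅)

/-- The sum of sectional curvatures `Σ_{i=1}^p Σ_{j=p+1}^n K(vⁱ,vʲ)`. -/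
def sumK {n : ℕ} (R : AlgCurv (EuclideanSpace ℝ (Fin n))) (p : ℕ)
    (v : Fin n → EuclideanSpace ℝ (Fin n)) : ℝ :=
  ∑ i ∈ Finset.univ.filter (fun i : Fin n => (i : ℕ) < p),
    ∑ j ∈ Finset.univ.filter (fun j : Fin n => p ≤ (j : ℕ)), sectK R (v i) (v j)

/-- The constant `D = (1/2)p(n−p) + (4/3)·binom(p,2)·binom(n−p,2)`. -/
def Dconst (n p : ℕ) : ℝ :=
  (1 : ℝ) / 2 * ((p * (n - p) : ℕ) : ℝ)
    + (4 : ℝ) / 3 * ((p.choose 2 * ((n - p).choose 2) : ℕ) : ℝ)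

/-- The pinching constant `C(n,p) = D/(1+D)`. -/
def Cnp (n p : ℕ) : ℝ := Dconst n p / (1 + Dconst n p)

section

open Finset

/-- Moving the element `i` of `S` to `j`. -/
def moveElt {n : ℕ} (i j : Fin n) (S : Finset (Fin n)) : Finset (Fin n) := insert j (S.erase i)

/-- The sign of `(aⁱ)* aʲ` at `S`. -/
def hopSign {n : ℕ} (i j : Fin n) (S : Finset (Fin n)) : ℝ := sgn i S * sgn j (S.erase i)

/-- The total weight of the edges leaving `S`. -/
def cutWeight {n : ℕ} (w : Fin n → Fin n → ℝ) (S : Finset (Fin n)) : ℝ :=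
  ∑ i ∈ S, ∑ j ∈ Sᶜ, w i j

/-- Rotation of a frame by `π / 4` in the plane of its vectors `a` and `b`. -/
def rotFrame {n : ℕ} {V : Type*} [AddCommGroup V] [Module ℝ V] (a b : Fin n) (v : Fin n → V) :
    Fin n → V :=
  fun i => if i = a then (√2)⁻¹ • (v a + v b) else if i = b then (√2)⁻¹ • (v a - v b) else v i

lemma sgn_mul_self {n : ℕ} (i : Fin n) (S : Finset (Fin n)) : sgn i S * sgn i S = 1 := by
  rw [sgn, ← mul_pow]; norm_num

lemma abs_sgn {n : ℕ} (i : Fin n) (S : Finset (Fin n)) : |sgn i S| = 1 := by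
  simp [sgn, abs_pow]

lemma sgn_insert_self {n : ℕ} (i : Fin n) (S : Finset (Fin n)) :
    sgn i (insert i S) = sgn i S := by
  simp [sgn, filter_insert]

lemma sgn_erase_self {n : ℕ} (i : Fin n) (S : Finset (Fin n)) :
    sgn i (S.erase i) = sgn i S := by
  by_cases h : i ∈ S
  · rw [← sgn_insert_self, insert_erase h]
  · rw [erase_eq_of_notMem h]

lemma sgn_insert {n : ℕ} {i j : Fin n} {S : Finset (Fin n)} (hj : j ∉ S) :
    sgn i (insert j S) = (if j < i then -1 else 1) * sgn i S := by
  unfold sgn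
  rw [filter_insert]
  split_ifs with h
  · rw [card_insert_of_notMem (by simp [hj]), pow_succ]; ring
  · simp

lemma abs_hopSign {n : ℕ} (i j : Fin n) (S : Finset (Fin n)) : |hopSign i j S| = 1 := by
  simp [hopSign, abs_mul, abs_sgn]

lemma wedgeE_contrE_apply {n : ℕ} {i j : Fin n} (hij : i ≠ j) (f : ExtCoord n)
    (S : Finset (Fin n)) :
    wedgeE i (contrE j f) S =
      if i ∈ S ∧ j ∈ Sᶜ then hopSign i j S * f (moveElt i j S) else 0 := by
  by_cases hi : i ∈ S <;> by_cases hj : j ∈ S <;>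
    simp [wedgeE, contrE, hopSign, moveElt, hi, hj, hij.symm, mul_assoc]

lemma hopSign_mul_back {n : ℕ} {i j : Fin n} {S : Finset (Fin n)} (hj : j ∉ S) :
    hopSign i j S * hopSign j i (moveElt i j S) = 1 := by
  have h : j ∉ S.erase i := by simp [hj]
  simp only [hopSign, moveElt, erase_insert h, sgn_insert_self, sgn_erase_self]
  linear_combination (sgn j (S.erase i) * sgn j (S.erase i)) * sgn_mul_self i S
    + sgn_mul_self j (S.erase i)

lemma hopSign_mul_trans {n : ℕ} {i j l : Fin n} {S : Finset (Fin n)} (hj : j ∉ S) :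
    hopSign i j S * hopSign j l (moveElt i j S) = hopSign i l S := by
  have h : j ∉ S.erase i := by simp [hj]
  simp only [hopSign, moveElt, erase_insert h, sgn_insert_self]
  linear_combination (sgn i S * sgn l (S.erase i)) * sgn_mul_self j (S.erase i)

lemma hopSign_mul_exchange {n : ℕ} {i j k : Fin n} {S : Finset (Fin n)} (hi : i ∈ S)
    (hj : j ∉ S) (hk : k ∈ S) (hki : k ≠ i) :
    hopSign i j S * hopSign k i (moveElt i j S) = - hopSign k j S := by
  obtain ⟨X, hiX, hkX, hjX, rfl⟩ :
      ∃ X : Finset (Fin n), i ∉ X ∧ k ∉ X ∧ j ∉ X ∧ S = insert i (insert k X) :=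
    ⟨(S.erase i).erase k, by grind, by grind, by grind, by grind⟩
  have hij : i ≠ j := by grind
  have hkj : k ≠ j := by grind
  have e1 : (insert i (insert k X)).erase i = insert k X := by grind
  have e2 : (insert i (insert k X)).erase k = insert i X := by grind
  have e3 : (insert j (insert k X)).erase k = insert j X := by grind
  have e4 : insert i (insert k X) = insert k (insert i X) := by grind
  have h4 : sgn k (insert i (insert k X)) = (if i < k then -1 else 1) * sgn k X := by
    rw [e4, sgn_insert_self, sgn_insert hiX]
  have h3 : sgn k (insert j (insert k X)) = (if j < k then -1 else 1) * sgn k X := by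
    rw [sgn_insert (by grind), sgn_insert_self]
  simp only [hopSign, moveElt, e1, e2, e3, h3, h4]
  rw [sgn_insert_self, sgn_insert (i := i) hkX, sgn_insert (i := j) hkX, sgn_insert (i := i) hjX,
    sgn_insert (i := j) hiX]
  have hs := sgn_mul_self i X
  split_ifs <;>
    first
    | (exfalso; omega)
    | linear_combination (sgn k X * sgn j X) * hs
    | linear_combination (-sgn k X * sgn j X) * hs

lemma moveElt_moveElt_back {n : ℕ} {i j : Fin n} {S : Finset (Fin n)} (hi : i ∈ S) (hj : j ∉ S) :
    moveElt j i (moveElt i j S) = S := by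
  unfold moveElt; grind

lemma moveElt_moveElt_trans {n : ℕ} {i j l : Fin n} {S : Finset (Fin n)} (hj : j ∉ S) :
    moveElt j l (moveElt i j S) = moveElt i l S := by
  unfold moveElt; grind

lemma moveElt_moveElt_exchange {n : ℕ} {i j k : Fin n} {S : Finset (Fin n)} (hi : i ∈ S)
    (hj : j ∉ S) (hki : k ≠ i) (hk : k ∈ S) :
    moveElt k i (moveElt i j S) = moveElt k j S := by
  unfold moveElt; grind

lemma card_moveElt {n : ℕ} {i j : Fin n} {S : Finset (Fin n)} (hi : i ∈ S) (hj : j ∉ S) :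
    (moveElt i j S).card = S.card := by
  rw [moveElt, card_insert_of_notMem (by simp [hj]), card_erase_add_one hi]

lemma sum_moveElt {n : ℕ} (G : Fin n → Fin n → Finset (Fin n) → ℝ) :
    ∑ S, ∑ i ∈ S, ∑ j ∈ Sᶜ, G i j (moveElt i j S) = ∑ S, ∑ i ∈ S, ∑ j ∈ Sᶜ, G j i S := by
  have key : ∀ H : Fin n → Fin n → Finset (Fin n) → ℝ,
      ∑ S, ∑ i ∈ S, ∑ j ∈ Sᶜ, H i j S =
        ∑ i, ∑ j, ∑ S ∈ univ.filter (fun S => i ∈ S ∧ j ∉ S), H i j S := by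
    intro H
    rw [sum_comm' (t' := univ) (s' := fun i => univ.filter (fun S => i ∈ S)) (by simp)]
    refine sum_congr rfl fun i _ => ?_
    rw [sum_comm' (t' := univ) (s' := fun j => univ.filter (fun S => i ∈ S ∧ j ∉ S)) (by simp)]
  rw [key, key, sum_comm]
  refine sum_congr rfl fun i _ => sum_congr rfl fun j _ => ?_
  refine sum_nbij' (moveElt j i) (moveElt i j) ?_ ?_ ?_ ?_ ?_
  · intro S hS
    simp only [mem_filter, mem_univ, true_and, moveElt] at *
    grind
  · intro S hS
    simp only [mem_filter, mem_univ, true_and, moveElt] at *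
    grind
  · intro S hS
    simp only [mem_filter, mem_univ, true_and] at hS
    exact moveElt_moveElt_back hS.1 hS.2
  · intro S hS
    simp only [mem_filter, mem_univ, true_and] at hS
    exact moveElt_moveElt_back hS.1 hS.2
  · intro S hS
    rfl

lemma sum_pair_erase_swap {n : ℕ} (S : Finset (Fin n)) (G : Fin n → Fin n → ℝ) :
    ∑ i ∈ S, ∑ j ∈ S.erase i, G i j = ∑ j ∈ S, ∑ i ∈ S.erase j, G i j :=
  sum_comm' (by grind)

/-- Evaluation of the Weitzenböck operator at `S`, by the number of indices moved. -/
lemma weitzOp_apply {n : ℕ} {c : Fin n → Fin n → Fin n → Fin n → ℝ}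
    (hc₁ : ∀ i k l, c i i k l = 0) (hc₂ : ∀ i j k, c i j k k = 0) (f : ExtCoord n)
    (S : Finset (Fin n)) :
    weitzOp c f S = cutWeight (fun i j => c i j j i) S * f S
      + ∑ i ∈ S, ∑ l ∈ Sᶜ, (∑ j ∈ Sᶜ.erase l, c i j j l - ∑ m ∈ S.erase i, c m l i m)
          * (hopSign i l S * f (moveElt i l S))
      + ∑ i ∈ S, ∑ j ∈ Sᶜ, ∑ k ∈ S.erase i, ∑ l ∈ Sᶜ.erase j,
          c i j k l * (hopSign i j S * hopSign k l (moveElt i j S)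
            * f (moveElt k l (moveElt i j S))) := by
  have h0 : weitzOp c f S = ∑ i ∈ S, ∑ j ∈ Sᶜ, ∑ k ∈ insert j (S.erase i),
      ∑ l ∈ insert i (Sᶜ.erase j), c i j k l * (hopSign i j S * hopSign k l (moveElt i j S)
            * f (moveElt k l (moveElt i j S))) := by
    simp only [weitzOp, Finset.sum_apply, Pi.smul_apply, smul_eq_mul]
    rw [← sum_subset (subset_univ S)]
    swap
    · intro i _ hi
      simp [wedgeE, hi]
    refine sum_congr rfl fun i hi => ?_
    rw [← sum_subset (subset_univ Sᶜ)]
    swap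
    · intro j _ hj
      refine sum_eq_zero fun k _ => sum_eq_zero fun l _ => ?_
      by_cases hij : i = j
      · subst hij; simp [hc₁]
      · rw [wedgeE_contrE_apply hij, if_neg (by tauto), mul_zero]
    refine sum_congr rfl fun j hj => ?_
    have hij : i ≠ j := by rintro rfl; simp_all
    have e1 : (insert j (S.erase i)) = moveElt i j S := rfl
    have e2 : (insert i (Sᶜ.erase j)) = (moveElt i j S)ᶜ := by
      unfold moveElt; ext x; simp at hj ⊢; grind
    rw [e1, e2, ← sum_subset (subset_univ (moveElt i j S))]
    swap
    · intro k _ hk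
      refine sum_eq_zero fun l _ => ?_
      rw [wedgeE_contrE_apply hij, if_pos ⟨hi, hj⟩]
      simp [wedgeE, hk]
    refine sum_congr rfl fun k hk => ?_
    rw [← sum_subset (subset_univ (moveElt i j S)ᶜ)]
    swap
    · intro l _ hl
      by_cases hkl : k = l
      · subst hkl; simp [hc₂]
      · rw [wedgeE_contrE_apply hij, if_pos ⟨hi, hj⟩, wedgeE_contrE_apply hkl, if_neg (by tauto)]
        simp
    refine sum_congr rfl fun l hl => ?_
    have hkl : k ≠ l := by rintro rfl; simp_all
    rw [wedgeE_contrE_apply hij, if_pos ⟨hi, hj⟩, wedgeE_contrE_apply hkl, if_pos ⟨hk, hl⟩]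
    ring
  have h1 : ∀ i ∈ S, ∀ j ∈ Sᶜ, ∑ k ∈ insert j (S.erase i),
      ∑ l ∈ insert i (Sᶜ.erase j), c i j k l * (hopSign i j S * hopSign k l (moveElt i j S)
            * f (moveElt k l (moveElt i j S))) =
      c i j j i * f S + ∑ l ∈ Sᶜ.erase j, c i j j l * (hopSign i l S * f (moveElt i l S))
      - ∑ k ∈ S.erase i, c i j k i * (hopSign k j S * f (moveElt k j S))
      + ∑ k ∈ S.erase i, ∑ l ∈ Sᶜ.erase j,
          c i j k l * (hopSign i j S * hopSign k l (moveElt i j S)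
            * f (moveElt k l (moveElt i j S))) := by
    intro i hi j hj
    rw [mem_compl] at hj
    rw [sum_insert (by simp [hj])]
    have hins : ∀ g : Fin n → ℝ, ∑ l ∈ insert i (Sᶜ.erase j), g l
        = g i + ∑ l ∈ Sᶜ.erase j, g l := fun g => sum_insert (by simp [hi])
    simp only [hins, sum_add_distrib]
    rw [hopSign_mul_back hj, moveElt_moveElt_back hi hj]
    simp only [hopSign_mul_trans hj, moveElt_moveElt_trans hj]
    have : ∑ k ∈ S.erase i, c i j k i * (hopSign i j S * hopSign k i (moveElt i j S)
          * f (moveElt k i (moveElt i j S)))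
        = - ∑ k ∈ S.erase i, c i j k i * (hopSign k j S * f (moveElt k j S)) := by
      rw [← sum_neg_distrib]
      refine sum_congr rfl fun k hk => ?_
      rw [mem_erase] at hk
      rw [hopSign_mul_exchange hi hj hk.2 hk.1, moveElt_moveElt_exchange hi hj hk.1 hk.2]
      ring
    rw [this]
    ring
  rw [h0, sum_congr rfl fun i hi => sum_congr rfl (h1 i hi)]
  simp only [sum_add_distrib, sum_sub_distrib, sub_mul, sum_mul, cutWeight]
  have h2 : ∑ i ∈ S, ∑ j ∈ Sᶜ, ∑ l ∈ Sᶜ.erase j, c i j j l * (hopSign i l S * f (moveElt i l S))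
      = ∑ i ∈ S, ∑ l ∈ Sᶜ, ∑ j ∈ Sᶜ.erase l, c i j j l * (hopSign i l S * f (moveElt i l S)) :=
    sum_congr rfl fun i _ => sum_pair_erase_swap _ _
  have h3 : ∑ i ∈ S, ∑ j ∈ Sᶜ, ∑ k ∈ S.erase i, c i j k i * (hopSign k j S * f (moveElt k j S))
      = ∑ k ∈ S, ∑ j ∈ Sᶜ, ∑ i ∈ S.erase k, c i j k i * (hopSign k j S * f (moveElt k j S)) := by
    rw [sum_comm]
    conv_rhs => rw [sum_comm]
    exact sum_congr rfl fun j _ => sum_pair_erase_swap _ _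
  rw [h2, h3]
  ring

lemma cutWeight_insert {n : ℕ} (w : Fin n → Fin n → ℝ) {a b : Fin n} {K L : Finset (Fin n)}
    (haK : a ∉ K) (hbL : b ∉ L) (hc : (insert a K)ᶜ = insert b L) :
    cutWeight w (insert a K) = ∑ m ∈ L, w a m + ∑ k ∈ K, w k b + w a b
      + ∑ k ∈ K, ∑ m ∈ L, w k m := by
  unfold cutWeight
  rw [hc, sum_insert haK, sum_insert hbL]
  simp only [sum_insert hbL, sum_add_distrib]
  ring

lemma cutWeight_moveElt_sub {n : ℕ} {w : Fin n → Fin n → ℝ} (hw : ∀ i j, w i j = w j i)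
    {a b : Fin n} {S : Finset (Fin n)} (ha : a ∈ S) (hb : b ∉ S) :
    cutWeight w S - cutWeight w (moveElt a b S) =
      ∑ m ∈ Sᶜ.erase b, (w a m - w b m) - ∑ k ∈ S.erase a, (w a k - w b k) := by
  have h1 := cutWeight_insert w (a := a) (b := b) (K := S.erase a) (L := Sᶜ.erase b)
    (by simp) (by simp) (by ext x; simp; grind)
  have h2 := cutWeight_insert w (a := b) (b := a) (K := S.erase a) (L := Sᶜ.erase b)
    (by simp [hb]) (by simp [ha]) (by ext x; simp; grind)
  rw [insert_erase ha] at h1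
  rw [moveElt, h1, h2, sum_sub_distrib, sum_sub_distrib, hw b a,
    sum_congr rfl fun k _ => hw k b, sum_congr rfl fun k _ => hw k a]
  ring

lemma cutWeight_insert_second_difference {n : ℕ} {w : Fin n → Fin n → ℝ}
    (hw : ∀ i j, w i j = w j i) {a b c d : Fin n} {K : Finset (Fin n)} (ha : a ∉ K) (hb : b ∉ K)
    (hc : c ∉ K) (hd : d ∉ K) (hab : a ≠ b) (hac : a ≠ c) (had : a ≠ d) (hbc : b ≠ c)
    (hbd : b ≠ d) (hcd : c ≠ d) :
    cutWeight w (insert a (insert b K)) - cutWeight w (insert a (insert d K))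
      - cutWeight w (insert c (insert b K)) + cutWeight w (insert c (insert d K))
      = 2 * (w a d + w c b - w a b - w c d) := by
  have m1 : moveElt a c (insert a (insert b K)) = insert c (insert b K) := by
    unfold moveElt; grind
  have m2 : moveElt a c (insert a (insert d K)) = insert c (insert d K) := by
    unfold moveElt; grind
  have h1 := cutWeight_moveElt_sub hw (a := a) (b := c) (S := insert a (insert b K))
    (by simp) (by grind)
  have h2 := cutWeight_moveElt_sub hw (a := a) (b := c) (S := insert a (insert d K))
    (by simp) (by grind)
  set L : Finset (Fin n) := (insert a (insert b (insert c (insert d K))))ᶜ with hL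
  have e1 : (insert a (insert b K)).erase a = insert b K := by grind
  have e2 : (insert a (insert d K)).erase a = insert d K := by grind
  have e3 : (insert a (insert b K))ᶜ.erase c = insert d L := by ext x; simp [hL]; grind
  have e4 : (insert a (insert d K))ᶜ.erase c = insert b L := by ext x; simp [hL]; grind
  rw [m1, e1, e3, sum_insert (by simp [hL]), sum_insert hb] at h1
  rw [m2, e2, e4, sum_insert (by simp [hL]), sum_insert hd] at h2
  linarith

lemma orthonormal_rotFrame {n : ℕ} {V : Type*} [NormedAddCommGroup V] [InnerProductSpace ℝ V]
    {a b : Fin n} (hab : a ≠ b) {v : Fin n → V} (hv : Orthonormal ℝ v) :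
    Orthonormal ℝ (rotFrame a b v) := by
  have h2 : (√2 : ℝ)⁻¹ * (√2)⁻¹ = 1 / 2 := by
    rw [← mul_inv, Real.mul_self_sqrt (by norm_num)]; norm_num
  rw [orthonormal_iff_ite] at hv ⊢
  intro i j
  unfold rotFrame
  split_ifs <;> subst_vars <;>
    simp only [inner_add_left, inner_add_right, inner_sub_left, inner_sub_right,
      real_inner_smul_left, real_inner_smul_right, hv] <;>
    simp_all [Ne.symm] <;> linear_combination 2 * h2

lemma exists_perm_mem_iff_val_lt {n p : ℕ} {S : Finset (Fin n)} (hS : S.card = p) :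
    ∃ σ : Equiv.Perm (Fin n), ∀ i, σ i ∈ S ↔ (i : ℕ) < p := by
  have hp : p ≤ n := by simpa [hS] using card_le_univ S
  have hcard : Fintype.card {i : Fin n // (i : ℕ) < p} = Fintype.card {i : Fin n // i ∈ S} := by
    rw [Fintype.card_subtype, Fin.card_filter_val_lt, Fintype.card_coe, hS, min_eq_right hp]
  let e := Fintype.equivOfCardEq hcard
  refine ⟨e.extendSubtype, fun i => ⟨fun h => ?_, e.extendSubtype_mem i⟩⟩
  by_contra hi
  exact e.extendSubtype_not_mem i hi h

lemma sectK_comm {V : Type*} [AddCommGroup V] [Module ℝ V] (R : AlgCurv V) (u v : V) :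
    sectK R u v = sectK R v u := by
  rw [sectK, sectK, R.antisym₁, R.antisym₂, neg_neg]

lemma AlgCurv.T_sub {V : Type*} [AddCommGroup V] [Module ℝ V] (R : AlgCurv V) (x y z t w : V) :
    R.T (x - y) z t w = R.T x z t w - R.T y z t w := by
  rw [R.antisym₁, R.antisym₁ x, R.antisym₁ y, map_sub, LinearMap.sub_apply, LinearMap.sub_apply]
  ring

/-- The hypothesis that `Σ_{i ≤ p} Σ_{j > p} K(vⁱ, vʲ)` lies in `(B, A)` for all orthonormal
bases. -/
def IsPinched {n : ℕ} (R : AlgCurv (EuclideanSpace ℝ (Fin n))) (p : ℕ) (A B : ℝ) : Prop :=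
  ∀ v : Fin n → EuclideanSpace ℝ (Fin n), Orthonormal ℝ v → B < sumK R p v ∧ sumK R p v < A

namespace IsPinched

variable {n p : ℕ} {R : AlgCurv (EuclideanSpace ℝ (Fin n))} {A B : ℝ}
  {v : Fin n → EuclideanSpace ℝ (Fin n)}

lemma cutWeight_mem_Ioo (h : IsPinched R p A B) (hv : Orthonormal ℝ v) {S : Finset (Fin n)}
    (hS : S.card = p) : cutWeight (fun i j => sectK R (v i) (v j)) S ∈ Set.Ioo B A := by
  obtain ⟨σ, hσ⟩ := exists_perm_mem_iff_val_lt hS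
  have key : sumK R p (v ∘ σ) = cutWeight (fun i j => sectK R (v i) (v j)) S := by
    unfold sumK cutWeight
    refine sum_equiv σ (by simp [hσ]) fun i _ => ?_
    exact sum_equiv σ (by simp [hσ]) fun j _ => rfl
  exact key ▸ h (v ∘ σ) (hv.comp σ σ.injective)

lemma abs_sum_sub_sum_le (h : IsPinched R p A B) (hv : Orthonormal ℝ v) {S : Finset (Fin n)}
    (hS : S.card = p) {a b : Fin n} (ha : a ∈ S) (hb : b ∉ S) :
    |∑ k ∈ S.erase a, R.T (v a) (v k) (v b) (v k) -
      ∑ m ∈ Sᶜ.erase b, R.T (v a) (v m) (v b) (v m)| ≤ (A - B) / 2 := by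
  have hab : a ≠ b := by rintro rfl; exact hb ha
  have hr := orthonormal_rotFrame hab hv
  have h1 := h.cutWeight_mem_Ioo hr hS
  have h2 := h.cutWeight_mem_Ioo hr ((card_moveElt ha hb).trans hS)
  have h3 := cutWeight_moveElt_sub
    (w := fun i j => sectK R (rotFrame a b v i) (rotFrame a b v j))
    (fun i j => sectK_comm R _ _) ha hb
  have hs : (√2 : ℝ)⁻¹ * (√2)⁻¹ = 1 / 2 := by
    rw [← mul_inv, Real.mul_self_sqrt (by norm_num)]; norm_num
  have key : ∀ m, m ≠ a → m ≠ b →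
      sectK R (rotFrame a b v a) (rotFrame a b v m) - sectK R (rotFrame a b v b) (rotFrame a b v m)
        = - 2 * R.T (v a) (v m) (v b) (v m) := by
    intro m hma hmb
    simp only [rotFrame, sectK, hma, hmb, hab.symm, if_true, if_false, map_add, map_sub, map_smul, R.T_sub,
      LinearMap.add_apply, LinearMap.sub_apply, LinearMap.smul_apply, smul_eq_mul]
    rw [R.pairsym (v b) (v m) (v a) (v m)]
    linear_combination (-4 * R.T (v a) (v m) (v b) (v m)) * hs
  rw [sum_congr rfl fun m hm => key m (by rintro rfl; simp_all) (by simp_all),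
    sum_congr rfl fun m hm => key m (by simp_all) (by rintro rfl; simp_all),
    ← mul_sum, ← mul_sum] at h3
  rw [abs_le]
  constructor <;> linarith [h1.1, h1.2, h2.1, h2.2]

lemma abs_add_le (h : IsPinched R p A B) (hv : Orthonormal ℝ v) {K : Finset (Fin n)}
    (hK : K.card + 2 = p) {a b c d : Fin n} (ha : a ∉ K) (hb : b ∉ K) (hc : c ∉ K) (hd : d ∉ K)
    (hab : a ≠ b) (hac : a ≠ c) (had : a ≠ d) (hbc : b ≠ c) (hbd : b ≠ d) (hcd : c ≠ d) :
    |R.T (v a) (v b) (v c) (v d) + R.T (v a) (v d) (v c) (v b)| ≤ (A - B) / 2 := by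
  have hr := orthonormal_rotFrame hbd (orthonormal_rotFrame hac hv)
  have hcard : ∀ x y, x ∉ K → y ∉ K → x ≠ y → (insert x (insert y K)).card = p := by
    intro x y hx hy hxy
    rw [card_insert_of_notMem (by simp [hx, hxy]), card_insert_of_notMem hy, ← hK]
  have h1 := h.cutWeight_mem_Ioo hr (hcard a b ha hb hab)
  have h2 := h.cutWeight_mem_Ioo hr (hcard a d ha hd had)
  have h3 := h.cutWeight_mem_Ioo hr (hcard c b hc hb hbc.symm)
  have h4 := h.cutWeight_mem_Ioo hr (hcard c d hc hd hcd)
  have h5 := cutWeight_insert_second_difference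
    (w := fun i j => sectK R (rotFrame b d (rotFrame a c v) i) (rotFrame b d (rotFrame a c v) j))
    (fun i j => sectK_comm R _ _) ha hb hc hd hab hac had hbc hbd hcd
  have hs : (√2 : ℝ)⁻¹ * (√2)⁻¹ = 1 / 2 := by
    rw [← mul_inv, Real.mul_self_sqrt (by norm_num)]; norm_num
  have hs4 : (√2 : ℝ)⁻¹ * (√2)⁻¹ * (√2)⁻¹ * (√2)⁻¹ = 1 / 4 := by
    linear_combination ((√2 : ℝ)⁻¹ * (√2)⁻¹ + 1 / 2) * hs
  have ea : rotFrame b d (rotFrame a c v) a = (√2)⁻¹ • (v a + v c) := by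
    simp [rotFrame, hab, had]
  have ec : rotFrame b d (rotFrame a c v) c = (√2)⁻¹ • (v a - v c) := by
    simp [rotFrame, hbc.symm, hcd, hac.symm]
  have eb : rotFrame b d (rotFrame a c v) b = (√2)⁻¹ • (v b + v d) := by
    simp [rotFrame, hab.symm, had.symm, hbc, hcd.symm]
  have ed : rotFrame b d (rotFrame a c v) d = (√2)⁻¹ • (v b - v d) := by
    simp [rotFrame, hab.symm, had.symm, hbc, hcd.symm, hbd.symm]
  have key : sectK R ((√2)⁻¹ • (v a + v c)) ((√2)⁻¹ • (v b - v d))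
      + sectK R ((√2)⁻¹ • (v a - v c)) ((√2)⁻¹ • (v b + v d))
      - sectK R ((√2)⁻¹ • (v a + v c)) ((√2)⁻¹ • (v b + v d))
      - sectK R ((√2)⁻¹ • (v a - v c)) ((√2)⁻¹ • (v b - v d))
      = 2 * (R.T (v a) (v b) (v c) (v d) + R.T (v a) (v d) (v c) (v b)) := by
    simp only [sectK, map_add, map_sub, map_smul, R.T_sub,
      LinearMap.add_apply, LinearMap.sub_apply, LinearMap.smul_apply, smul_eq_mul]
    rw [R.pairsym (v c) (v d) (v a) (v b), R.pairsym (v c) (v b) (v a) (v d)]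
    linear_combination
      (8 * (R.T (v a) (v b) (v c) (v d) + R.T (v a) (v d) (v c) (v b))) * hs4
  simp only [ea, eb, ec, ed] at h5
  rw [abs_le]
  constructor <;> linarith [h1.1, h1.2, h2.1, h2.2, h3.1, h3.2, h4.1, h4.2]

lemma abs_le_div_three (h : IsPinched R p A B) (hv : Orthonormal ℝ v) {K : Finset (Fin n)}
    (hK : K.card + 2 = p) {a b c d : Fin n} (ha : a ∉ K) (hb : b ∉ K) (hc : c ∉ K) (hd : d ∉ K)
    (hab : a ≠ b) (hac : a ≠ c) (had : a ≠ d) (hbc : b ≠ c) (hbd : b ≠ d) (hcd : c ≠ d) :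
    |R.T (v a) (v b) (v c) (v d)| ≤ (A - B) / 3 := by
  have h1 := abs_le.1 (h.abs_add_le hv hK ha hb hc hd hab hac had hbc hbd hcd)
  have h2 := abs_le.1 (h.abs_add_le hv hK ha hb hd hc hab had hac hbd hbc hcd.symm)
  have e1 := R.bianchi (v a) (v b) (v c) (v d)
  have e2 := R.pairsym (v b) (v c) (v a) (v d)
  have e3 := R.antisym₂ (v a) (v d) (v b) (v c)
  have e4 := R.antisym₁ (v c) (v a) (v b) (v d)
  have e5 := R.antisym₂ (v a) (v c) (v b) (v d)
  have e6 := R.antisym₂ (v a) (v b) (v c) (v d)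
  rw [abs_le]
  constructor <;> linarith [h1.1, h1.2, h2.1, h2.2]

end IsPinched

lemma sum_neighbors_const {n p : ℕ} {g : Finset (Fin n) → ℝ}
    (hg : ∀ S, S.card ≠ p → g S = 0) :
    ∑ S, ∑ _i ∈ S, ∑ _j ∈ Sᶜ, g S = (p * (n - p) : ℕ) * ∑ S, g S := by
  rw [mul_sum]
  refine sum_congr rfl fun S _ => ?_
  by_cases hS : S.card = p
  · simp [hS, card_compl, mul_assoc]
  · simp [hg S hS]

lemma sum_neighbors {n p : ℕ} {g : Finset (Fin n) → ℝ}
    (hg : ∀ S, S.card ≠ p → g S = 0) :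
    ∑ S, ∑ i ∈ S, ∑ j ∈ Sᶜ, g (moveElt i j S) = (p * (n - p) : ℕ) * ∑ S, g S := by
  rw [sum_moveElt fun _ _ => g, sum_neighbors_const hg]

lemma sum_erase_erase_const {n p : ℕ} {g : Finset (Fin n) → ℝ}
    (hg : ∀ S, S.card ≠ p → g S = 0) :
    ∑ S : Finset (Fin n), ∑ i ∈ S, ∑ j ∈ Sᶜ, ∑ _k ∈ S.erase i, ∑ _l ∈ Sᶜ.erase j, g S
      = (p * (n - p) * ((p - 1) * (n - p - 1)) : ℕ) * ∑ S, g S := by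
  have h := sum_neighbors_const (p := p) (g := fun S => ((p - 1) * (n - p - 1) : ℕ) * g S)
    fun S hS => by simp [hg S hS]
  rw [← mul_sum, ← mul_assoc, ← Nat.cast_mul] at h
  rw [← h]
  refine sum_congr rfl fun S _ => sum_congr rfl fun i hi => sum_congr rfl fun j hj => ?_
  by_cases hS : S.card = p
  · simp [card_erase_of_mem hi, card_erase_of_mem hj, card_compl, hS, mul_assoc]
  · simp [hg S hS]

lemma sum_neighbors_neighbors {n p : ℕ} {g : Finset (Fin n) → ℝ}
    (hg : ∀ S, S.card ≠ p → g S = 0) :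
    ∑ S : Finset (Fin n), ∑ i ∈ S, ∑ j ∈ Sᶜ, ∑ k ∈ S.erase i, ∑ l ∈ Sᶜ.erase j,
        g (moveElt k l (moveElt i j S))
      = (p * (n - p) * ((p - 1) * (n - p - 1)) : ℕ) * ∑ S, g S := by
  have h1 := sum_moveElt fun i j T : _ => ∑ k ∈ T.erase j, ∑ l ∈ Tᶜ.erase i, g (moveElt k l T)
  have h2 := sum_moveElt fun i j T : _ => ∑ k ∈ T.erase j, ∑ l ∈ Tᶜ.erase i, g T
  rw [← sum_erase_erase_const hg, ← h2]
  have h3 : ∀ S : Finset (Fin n), ∀ i ∈ S, ∀ j ∈ Sᶜ,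
      (moveElt i j S).erase j = S.erase i ∧ (moveElt i j S)ᶜ.erase i = Sᶜ.erase j := by
    intro S i hi j hj
    rw [mem_compl] at hj
    unfold moveElt
    constructor
    · grind
    · ext x; simp; grind
  calc _ = _ := ?_
    _ = _ := h1
    _ = _ := ?_
  · refine sum_congr rfl fun S _ => sum_congr rfl fun i hi => sum_congr rfl fun j hj => ?_
    rw [(h3 S i hi j hj).1, (h3 S i hi j hj).2]
  · refine sum_congr rfl fun S _ => ?_
    have e : ∀ F : Fin n → Fin n → ℝ, ∑ i ∈ S, ∑ j ∈ Sᶜ, ∑ k ∈ S.erase i, ∑ l ∈ Sᶜ.erase j, F k l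
        = ∑ k ∈ S, ∑ l ∈ Sᶜ, ∑ i ∈ S.erase k, ∑ j ∈ Sᶜ.erase l, F k l := by
      intro F
      calc _ = ∑ i ∈ S, ∑ k ∈ S.erase i, ∑ j ∈ Sᶜ, ∑ l ∈ Sᶜ.erase j, F k l :=
            sum_congr rfl fun i _ => sum_comm
        _ = ∑ k ∈ S, ∑ i ∈ S.erase k, ∑ l ∈ Sᶜ, ∑ j ∈ Sᶜ.erase l, F k l := by
            rw [sum_pair_erase_swap]
            exact sum_congr rfl fun k _ => sum_congr rfl fun i _ => sum_pair_erase_swap _ _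
        _ = _ := sum_congr rfl fun k _ => sum_comm
    rw [e]
    refine sum_congr rfl fun k hk => sum_congr rfl fun l hl => ?_
    rw [(h3 S k hk l hl).1, (h3 S k hk l hl).2]

lemma abs_mul_mul_ge {x y m s t : ℝ} (hm : |m| ≤ t) (hs : |s| = 1) :
    -(t * ((x ^ 2 + y ^ 2) / 2)) ≤ m * (s * y) * x := by
  have h1 : |m * (s * y) * x| ≤ t * (|x| * |y|) := by
    rw [abs_mul, abs_mul, abs_mul, hs]
    nlinarith [mul_le_mul_of_nonneg_right hm (mul_nonneg (abs_nonneg x) (abs_nonneg y))]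
  have h2 : |x| * |y| ≤ (x ^ 2 + y ^ 2) / 2 := by
    nlinarith [sq_nonneg (|x| - |y|), sq_abs x, sq_abs y]
  have h3 := mul_le_mul_of_nonneg_left h2 ((abs_nonneg m).trans hm)
  linarith [neg_abs_le (m * (s * y) * x)]

lemma orthonormal_estd (n : ℕ) : Orthonormal ℝ (estd : Fin n → EuclideanSpace ℝ (Fin n)) :=
  EuclideanSpace.orthonormal_single

lemma Dconst_eq {n p : ℕ} (hp : 1 ≤ p) (hpn : p + 1 ≤ n) :
    Dconst n p = (p * (n - p) : ℕ) / 2 + (p * (n - p) * ((p - 1) * (n - p - 1)) : ℕ) / 3 := by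
  obtain ⟨q, rfl⟩ : ∃ q, p = q + 1 := ⟨p - 1, by omega⟩
  obtain ⟨m, rfl⟩ : ∃ m, n = q + 1 + (m + 1) := ⟨n - (q + 1) - 1, by omega⟩
  simp only [Dconst, Nat.add_sub_cancel_left, Nat.add_sub_cancel, Nat.cast_mul,
    Nat.cast_choose_two]
  push_cast
  ring

/-- Lower bound for the contribution of one component to the Weitzenböck quadratic form. -/
lemma IsPinched.weitz_apply_mul_ge {n p : ℕ} {R : AlgCurv (EuclideanSpace ℝ (Fin n))} {A B : ℝ}
    (h : IsPinched R p A B) (ω : ExtCoord n) {S : Finset (Fin n)} (hS : S.card = p) :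
    cutWeight (fun i j => sectK R (estd i) (estd j)) S * ω S ^ 2
      - ∑ i ∈ S, ∑ l ∈ Sᶜ, (A - B) / 2 * ((ω S ^ 2 + ω (moveElt i l S) ^ 2) / 2)
      - ∑ i ∈ S, ∑ j ∈ Sᶜ, ∑ k ∈ S.erase i, ∑ l ∈ Sᶜ.erase j,
          (A - B) / 3 * ((ω S ^ 2 + ω (moveElt k l (moveElt i j S)) ^ 2) / 2)
      ≤ weitz R ω S * ω S := by
  have he := orthonormal_estd n
  have hc₁ : ∀ x z w, R.T x x z w = 0 := fun x z w => by linarith [R.antisym₁ x x z w]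
  have hc₂ : ∀ x y z, R.T x y z z = 0 := fun x y z => by linarith [R.antisym₂ x y z z]
  rw [weitz, weitzOp_apply (fun i k l => hc₁ _ _ _) (fun i j k => hc₂ _ _ _), add_mul, add_mul,
    sub_eq_add_neg, sub_eq_add_neg]
  refine add_le_add (add_le_add (le_of_eq ?_) ?_) ?_
  · have : ∀ x y, R.T x y y x = sectK R x y := fun x y => by rw [sectK, R.antisym₂]
    simp only [this]
    ring
  · simp only [sum_mul, ← sum_neg_distrib]
    refine sum_le_sum fun i hi => sum_le_sum fun l hl => ?_
    rw [mem_compl] at hl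
    refine abs_mul_mul_ge (le_of_eq_of_le ?_ (h.abs_sum_sub_sum_le he hS hi hl))
      (abs_hopSign i l S)
    have e1 : ∀ m, R.T (estd i) (estd m) (estd m) (estd l)
        = - R.T (estd i) (estd m) (estd l) (estd m) := fun m => R.antisym₂ _ _ _ _
    have e2 : ∀ m, R.T (estd m) (estd l) (estd i) (estd m)
        = - R.T (estd i) (estd m) (estd l) (estd m) := fun m => by
      rw [R.pairsym, R.antisym₂]
    simp only [e1, e2, sum_neg_distrib]
    ring_nf
  · simp only [sum_mul, ← sum_neg_distrib]
    refine sum_le_sum fun i hi => sum_le_sum fun j hj => sum_le_sum fun k hk =>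
      sum_le_sum fun l hl => ?_
    simp only [mem_erase, mem_compl] at hj hk hl
    refine abs_mul_mul_ge ?_ (by rw [abs_mul, abs_hopSign, abs_hopSign, one_mul])
    refine h.abs_le_div_three he (K := (S.erase i).erase k) ?_ (by simp) (by simp [hj])
      (by simp) (by simp [hl]) ?_ hk.1.symm ?_ ?_ hl.1.symm ?_
    · have h1 := card_erase_add_one hi
      have h2 := card_erase_add_one (mem_erase.2 hk)
      omega
    all_goals rintro rfl; tauto

end

/-- quantitative bound from the proof of Corollary 3.1. If
`B < Σ_{i≤p} Σ_{j>p} K(vⁱ,vʲ) < A` for every orthonormal basis, then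
`⟨R^p ω, ω⟩ > B − D·(A−B)` for every unit `ω ∈ ⋀^p ℝⁿ`. -/
theorem statement1 (n p : ℕ) (hn : 4 ≤ n) (hp2 : 2 ≤ p) (hpn : p ≤ n - 2)
    (R : AlgCurv (EuclideanSpace ℝ (Fin n))) (A B : ℝ) (hBA : B < A)
    (hpinch : ∀ v : Fin n → EuclideanSpace ℝ (Fin n), Orthonormal ℝ v →
      B < sumK R p v ∧ sumK R p v < A)
    (ω : ExtCoord n) (hω : ∀ S, S.card ≠ p → ω S = 0)
    (hunit : extInner ω ω = 1) :
    B - Dconst n p * (A - B) < extInner (weitz R ω) ω := by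
  have h : IsPinched R p A B := hpinch
  have hg : ∀ S : Finset (Fin n), S.card ≠ p → ω S ^ 2 = 0 := fun S hS => by simp [hω S hS]
  have hone : ∑ S, ω S ^ 2 = 1 := by simpa only [extInner, ← pow_two] using hunit
  have hcut : B < ∑ S, cutWeight (fun i j => sectK R (estd i) (estd j)) S * ω S ^ 2 := by
    rw [← mul_one B, ← hone, Finset.mul_sum]
    have hlt : ∀ S : Finset (Fin n), S.card = p →
        B < cutWeight (fun i j => sectK R (estd i) (estd j)) S := fun S hS =>
      (h.cutWeight_mem_Ioo (orthonormal_estd n) hS).1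
    obtain ⟨S, -, hS⟩ := Finset.exists_ne_zero_of_sum_ne_zero (hone.trans_ne one_ne_zero)
    refine Finset.sum_lt_sum (fun T _ => ?_) ⟨S, Finset.mem_univ S, ?_⟩
    · by_cases hT : T.card = p
      · exact mul_le_mul_of_nonneg_right (hlt T hT).le (sq_nonneg _)
      · simp [hg T hT]
    · exact mul_lt_mul_of_pos_right (hlt S (not_imp_comm.1 (hg S) hS))
        ((sq_nonneg _).lt_of_ne' hS)
  have hsum := Finset.sum_le_sum fun (S : Finset (Fin n)) (_ : S ∈ Finset.univ) =>
    show cutWeight (fun i j => sectK R (estd i) (estd j)) S * ω S ^ 2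
      - ∑ i ∈ S, ∑ l ∈ Sᶜ, (A - B) / 2 * ((ω S ^ 2 + ω (moveElt i l S) ^ 2) / 2)
      - ∑ i ∈ S, ∑ j ∈ Sᶜ, ∑ k ∈ S.erase i, ∑ l ∈ Sᶜ.erase j,
          (A - B) / 3 * ((ω S ^ 2 + ω (moveElt k l (moveElt i j S)) ^ 2) / 2)
      ≤ weitz R ω S * ω S from by
    by_cases hS : S.card = p
    · exact h.weitz_apply_mul_ge ω hS
    · rw [hω S hS, mul_zero, zero_pow two_ne_zero, mul_zero, zero_sub, sub_nonpos]
      have hAB : 0 ≤ A - B := by linarith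
      exact (neg_nonpos.2 (Finset.sum_nonneg fun i _ => Finset.sum_nonneg fun l _ => by
        positivity)).trans (Finset.sum_nonneg fun i _ => Finset.sum_nonneg fun j _ =>
          Finset.sum_nonneg fun k _ => Finset.sum_nonneg fun l _ => by positivity)
  simp only [Finset.sum_sub_distrib, ← Finset.mul_sum, ← Finset.sum_div,
    Finset.sum_add_distrib] at hsum
  rw [sum_neighbors_const hg, sum_neighbors hg, sum_erase_erase_const hg,
    sum_neighbors_neighbors hg, hone] at hsum
  rw [Dconst_eq (by omega) (by omega)]
  unfold extInner
  linarith

end
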